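/- arXiv:2310.11905 — 2 statements merged into one kernel-verified Lean document; each statement's English description precedes it below -/
import Mathlib

section
/- There exist T_g > 0 and a continuously differentiable function z = (z₁, z₂) : ℝ → ℝ² such that z₁'(t) = -∂₂g(z₁(t), z₂(t)) and z₂'(t) = ∂₁g(z₁(t), z₂(t)) for all t ∈ ℝ, z(0) = x₀, z is periodic with z(t + T_g) = z(t) for all t, and T_g is the minimal (main) period of z. -/
/-- The first partial derivative of `f : ℝ × ℝ → ℝ`. -/
noncomputable def pd1 (f : ℝ × ℝ → ℝ) (x : ℝ × ℝ) : ℝ := fderiv ℝ f x (1, 0)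

/-- The second partial derivative of `f : ℝ × ℝ → ℝ`. -/
noncomputable def pd2 (f : ℝ × ℝ → ℝ) (x : ℝ × ℝ) : ℝ := fderiv ℝ f x (0, 1)

open Set Filter Topology

/-- The Hamiltonian vector field `(-∂₂g, ∂₁g)` of `g`. -/
noncomputable def hamField (g : ℝ × ℝ → ℝ) (x : ℝ × ℝ) : ℝ × ℝ := (-pd2 g x, pd1 g x)

lemma fderiv_apply_eq_hamField (g : ℝ × ℝ → ℝ) (x v : ℝ × ℝ) :
    fderiv ℝ g x v = (hamField g x).2 * v.1 - (hamField g x).1 * v.2 := by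
  have hv : v = v.1 • ((1 : ℝ), (0 : ℝ)) + v.2 • ((0 : ℝ), (1 : ℝ)) := by
    ext <;> simp
  conv_lhs => rw [hv]
  rw [map_add, map_smul, map_smul]
  simp only [hamField, pd1, pd2, smul_eq_mul]
  ring

lemma hamField_ne_zero {g : ℝ × ℝ → ℝ} {x : ℝ × ℝ} (h : fderiv ℝ g x ≠ 0) :
    hamField g x ≠ 0 := by
  intro h0
  apply h
  ext <;> simp [fderiv_apply_eq_hamField, h0]

lemma continuousAt_hamField {g : ℝ × ℝ → ℝ} {x : ℝ × ℝ} (hg : ContDiffAt ℝ 1 g x) :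
    ContinuousAt (hamField g) x := by
  have h : ContinuousAt (fderiv ℝ g) x := (hg.fderiv_right (m := 0) (by norm_num)).continuousAt
  exact ((h.clm_apply continuousAt_const).neg).prodMk (h.clm_apply continuousAt_const)

/-- A form of the inverse function theorem. -/
lemma exists_contDiffAt_local_inverse {E : Type*} [NormedAddCommGroup E] [NormedSpace ℝ E]
    [CompleteSpace E] {f : E → E} {a : E} (hf : ContDiffAt ℝ 1 f a) (e : E ≃L[ℝ] E)
    (he : HasFDerivAt f (e : E →L[ℝ] E) a) :
    ∃ ψ : E → E, ContDiffAt ℝ 1 ψ (f a) ∧ ψ (f a) = a ∧ (∀ᶠ x in 𝓝 a, ψ (f x) = x) ∧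
      ∀ᶠ y in 𝓝 (f a), f (ψ y) = y :=
  ⟨hf.localInverse he one_ne_zero, hf.to_localInverse he one_ne_zero,
    hf.localInverse_apply_image he one_ne_zero,
    (hf.hasStrictFDerivAt' he one_ne_zero).eventually_left_inverse,
    (hf.hasStrictFDerivAt' he one_ne_zero).eventually_right_inverse⟩

/-- Time change for a scalar autonomous equation `ds/dt = f s` near an initial condition `0` with
`f > 0`: `T` is the time function, `σ` the solution. -/
lemma exists_time_function {f : ℝ → ℝ} {δ : ℝ} (hδ : 0 < δ)
    (hc : ∀ s, |s| ≤ δ → ContinuousAt f s) (hf : ∀ s, |s| ≤ δ → 0 < f s) :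
    ∃ (T σ : ℝ → ℝ) (ε : ℝ), 0 < ε ∧ T 0 = 0 ∧
      (∀ s, |s| < δ → HasDerivAt T (f s)⁻¹ s) ∧ (∀ᶠ s in 𝓝 0, σ (T s) = s) ∧
      ∀ t, |t| < ε → |σ t| < δ ∧ HasDerivAt σ (f (σ t)) t := by
  have hle : -δ ≤ δ := by linarith
  set h : ℝ → ℝ := fun s => (f (projIcc (-δ) δ hle s))⁻¹ with hh
  have hmem : ∀ s : ℝ, |((projIcc (-δ) δ hle s : Icc (-δ) δ) : ℝ)| ≤ δ := fun s =>
    abs_le.2 (projIcc (-δ) δ hle s).2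
  have hcont : Continuous h := by
    rw [continuous_iff_continuousAt]
    intro s
    have h1 : ContinuousAt (fun s => ((projIcc (-δ) δ hle s : Icc (-δ) δ) : ℝ)) s :=
      (continuous_subtype_val.comp continuous_projIcc).continuousAt
    exact (ContinuousAt.comp' (f := fun s => ((projIcc (-δ) δ hle s : Icc (-δ) δ) : ℝ)) (g := f)
      (hc _ (hmem s)) h1).inv₀ (hf _ (hmem s)).ne'
  have hval : ∀ s, |s| < δ → h s = (f s)⁻¹ := fun s hs => by
    rw [hh]
    simp only
    rw [projIcc_of_mem hle (abs_le.1 hs.le)]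
  set T : ℝ → ℝ := fun s => ∫ r in (0 : ℝ)..s, h r with hT
  have hTd : ∀ s, HasDerivAt T (h s) s := fun s =>
    (hcont.integral_hasStrictDerivAt 0 s).hasDerivAt
  have hTd' : ∀ s, |s| < δ → HasDerivAt T (f s)⁻¹ s := fun s hs => hval s hs ▸ hTd s
  have hT0 : T 0 = 0 := by simp [hT]
  have hTc : ContDiff ℝ 1 T := by
    rw [contDiff_one_iff_deriv]
    refine ⟨fun s => (hTd s).differentiableAt, ?_⟩
    rwa [funext fun s => (hTd s).deriv]
  have h0 : |(0 : ℝ)| < δ := by simpa using hδ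
  have hne : h 0 ≠ 0 := by rw [hval 0 h0]; exact (inv_pos.2 (hf 0 h0.le)).ne'
  obtain ⟨σ, hσc, hσ0, hl, hr⟩ := exists_contDiffAt_local_inverse hTc.contDiffAt
    (ContinuousLinearEquiv.unitsEquivAut ℝ (Units.mk0 _ hne)) ((hTd 0).hasFDerivAt_equiv hne)
  rw [hT0] at hσc hσ0 hr
  have hsmall : ∀ᶠ t in 𝓝 (0 : ℝ), |σ t| < δ :=
    hσc.continuousAt.abs.eventually_lt continuousAt_const (by rw [hσ0]; exact h0)
  obtain ⟨ε, hε, H⟩ := Metric.eventually_nhds_iff.1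
    (hsmall.and ((hσc.eventually (by simp)).and hr.eventually_nhds))
  refine ⟨T, σ, ε, hε, hT0, hTd', hl, fun t ht => ?_⟩
  obtain ⟨h1, h2, h3⟩ := H (y := t) (by simpa using ht)
  refine ⟨h1, ?_⟩
  have := HasDerivAt.of_local_left_inverse h2.continuousAt (hTd' _ h1)
    (inv_pos.2 (hf _ h1.le)).ne' h3
  simpa using this

/-- Near a regular point `p` of the level set `g = 0`, this level set is a curve `η` parametrised by
the linear functional dual to `hamField g p`. -/
lemma exists_level_curve {g : ℝ × ℝ → ℝ} {p : ℝ × ℝ} (hg : ContDiffAt ℝ 1 g p) (hp : g p = 0)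
    (hd : fderiv ℝ g p ≠ 0) {V : Set (ℝ × ℝ)} (hV : V ∈ 𝓝 p) :
    ∃ (l : ℝ × ℝ →L[ℝ] ℝ) (η : ℝ → ℝ × ℝ) (δ : ℝ), 0 < δ ∧
      (∀ᶠ x in 𝓝 p, g x = 0 → η (l (x - p)) = x) ∧
      ∀ s, |s| ≤ δ → η s ∈ V ∧ g (η s) = 0 ∧ 0 < l (hamField g (η s)) ∧
        ContinuousAt (fun r => l (hamField g (η r))) s ∧
        HasDerivAt η ((l (hamField g (η s)))⁻¹ • hamField g (η s)) s := by
  set a := (hamField g p).1 with ha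
  set b := (hamField g p).2 with hb
  have hab : 0 < a ^ 2 + b ^ 2 := by
    have hX := hamField_ne_zero hd
    by_contra! hcon
    apply hX
    have h1 : a = 0 := by nlinarith [sq_nonneg a, sq_nonneg b]
    have h2 : b = 0 := by nlinarith [sq_nonneg a, sq_nonneg b]
    exact Prod.ext h1 h2
  set l : ℝ × ℝ →L[ℝ] ℝ :=
    a • ContinuousLinearMap.fst ℝ ℝ ℝ + b • ContinuousLinearMap.snd ℝ ℝ ℝ with hl
  have hlv : ∀ v : ℝ × ℝ, l v = a * v.1 + b * v.2 := fun v => by simp [hl]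
  set Φ : ℝ × ℝ → ℝ × ℝ := fun x => (l (x - p), g x) with hΦ
  have hΦp : Φ p = (0, 0) := by simp [hΦ, hp]
  have hΦc : ContDiffAt ℝ 1 Φ p :=
    (l.contDiff.contDiffAt.comp p (contDiffAt_id.sub contDiffAt_const)).prodMk hg
  have hgd : DifferentiableAt ℝ g p := hg.differentiableAt one_ne_zero
  have hinj : Function.Injective (l.prod (fderiv ℝ g p)) := by
    rw [injective_iff_map_eq_zero]
    intro v hv
    have h1 : a * v.1 + b * v.2 = 0 := by
      rw [← hlv]; exact congrArg Prod.fst hv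
    have h2 : b * v.1 - a * v.2 = 0 := by
      rw [← fderiv_apply_eq_hamField]; exact congrArg Prod.snd hv
    have e1 : (a ^ 2 + b ^ 2) * v.1 = 0 := by linear_combination a * h1 + b * h2
    have e2 : (a ^ 2 + b ^ 2) * v.2 = 0 := by linear_combination b * h1 - a * h2
    exact Prod.ext ((mul_eq_zero.1 e1).resolve_left hab.ne')
      ((mul_eq_zero.1 e2).resolve_left hab.ne')
  set e : (ℝ × ℝ) ≃L[ℝ] (ℝ × ℝ) :=
    (LinearEquiv.ofInjectiveEndo (l.prod (fderiv ℝ g p)).toLinearMap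
      hinj).toContinuousLinearEquiv
  have hΦd : HasFDerivAt Φ (e : (ℝ × ℝ) →L[ℝ] (ℝ × ℝ)) p := by
    have h1 : HasFDerivAt Φ (l.prod (fderiv ℝ g p)) p := by
      refine HasFDerivAt.prodMk ?_ hgd.hasFDerivAt
      exact l.hasFDerivAt.comp (f := fun x => x - p) p ((hasFDerivAt_id p).sub_const p)
    have h2 : (e : (ℝ × ℝ) →L[ℝ] (ℝ × ℝ)) = l.prod (fderiv ℝ g p) := by
      ext <;> rfl
    rwa [h2]
  obtain ⟨Ψ, hΨc, hΨ0, hleft, hright⟩ := exists_contDiffAt_local_inverse hΦc e hΦd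
  rw [hΦp] at hΨc hΨ0 hright
  have hι : Tendsto (fun s : ℝ => (s, (0 : ℝ))) (𝓝 0) (𝓝 (0, 0)) :=
    (by fun_prop : Continuous fun s : ℝ => (s, (0 : ℝ))).tendsto' _ _ rfl
  have hηt : Tendsto (fun s : ℝ => Ψ (s, 0)) (𝓝 0) (𝓝 p) := by
    have := hΨc.continuousAt.tendsto.comp hι
    rwa [hΨ0] at this
  have hpos : ∀ᶠ x in 𝓝 p, 0 < l (hamField g x) := by
    refine continuousAt_const.eventually_lt
      (l.continuous.continuousAt.comp (continuousAt_hamField hg)) ?_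
    simp only [hlv, ← ha, ← hb]
    nlinarith
  have hxev : ∀ᶠ x in 𝓝 p, x ∈ V ∧ ContDiffAt ℝ 1 g x ∧ 0 < l (hamField g x) :=
    (eventually_mem_set.2 hV).and ((hg.eventually (by simp)).and hpos)
  obtain ⟨δ, hδ, H⟩ := Metric.eventually_nhds_iff.1 ((hηt.eventually hxev).and
    ((hι.eventually (hΨc.eventually (by simp))).and (hι.eventually hright).eventually_nhds))
  refine ⟨l, fun s => Ψ (s, 0), δ / 2, by positivity, ?_, fun s hs => ?_⟩
  · filter_upwards [hleft] with x hx hgx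
    rw [← hgx]
    exact hx
  · obtain ⟨⟨h1, h2, h3⟩, h4, h5⟩ := H (y := s) (by
      rw [Real.dist_eq, sub_zero]; linarith)
    have hgη : ∀ᶠ r in 𝓝 s, g (Ψ (r, 0)) = 0 := h5.mono fun r hr => congrArg Prod.snd hr
    have hlη : ∀ᶠ r in 𝓝 s, l (Ψ (r, 0) - p) = r := h5.mono fun r hr => congrArg Prod.fst hr
    have hηd : DifferentiableAt ℝ (fun r : ℝ => Ψ (r, 0)) s :=
      DifferentiableAt.comp s (h4.differentiableAt one_ne_zero)
        (differentiableAt_id.prodMk (differentiableAt_const _))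
    refine ⟨h1, hgη.self_of_nhds, h3, ?_, ?_⟩
    · exact l.continuous.continuousAt.comp
        (ContinuousAt.comp (g := hamField g) (continuousAt_hamField h2) hηd.continuousAt)
    · have hη' := hηd.hasDerivAt
      set v := deriv (fun r : ℝ => Ψ (r, 0)) s
      have e1 : l v = 1 := by
        have q : HasDerivAt (fun r => l (Ψ (r, 0) - p)) (l v) s :=
          l.hasFDerivAt.comp_hasDerivAt s (hη'.sub_const p)
        exact q.unique ((hasDerivAt_id s).congr_of_eventuallyEq hlη)
      have e2 : fderiv ℝ g (Ψ (s, 0)) v = 0 := by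
        have q : HasDerivAt (fun r => g (Ψ (r, 0))) (fderiv ℝ g (Ψ (s, 0)) v) s :=
          (h2.differentiableAt one_ne_zero).hasFDerivAt.comp_hasDerivAt s hη'
        exact q.unique ((hasDerivAt_const s (0 : ℝ)).congr_of_eventuallyEq hgη)
      rw [fderiv_apply_eq_hamField] at e2
      set X := hamField g (Ψ (s, 0)) with hX
      have e3 : l X • v = X := by
        rw [hlv] at e1 ⊢
        ext
        · simp only [Prod.smul_fst, smul_eq_mul]
          linear_combination X.1 * e1 + b * e2
        · simp only [Prod.smul_snd, smul_eq_mul]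
          linear_combination X.2 * e1 - a * e2
      have e4 : v = (l X)⁻¹ • X := by
        rw [eq_inv_smul_iff₀ h3.ne', e3]
      rwa [e4] at hη'

/-- Flow box: near a regular point of the level set `g = 0` there is a time function `τ` and an
integral curve `γ` of the Hamiltonian field which parametrises the level set and is inverse to
`τ`. -/
lemma exists_flow_box {g : ℝ × ℝ → ℝ} {p : ℝ × ℝ} (hg : ContDiffAt ℝ 1 g p) (hp : g p = 0)
    (hd : fderiv ℝ g p ≠ 0) {V : Set (ℝ × ℝ)} (hV : V ∈ 𝓝 p) :
    ∃ (W : Set (ℝ × ℝ)) (τ : ℝ × ℝ → ℝ) (γ : ℝ → ℝ × ℝ) (ε : ℝ), W ∈ 𝓝 p ∧ 0 < ε ∧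
      (∀ x ∈ W, g x = 0 → |τ x| < ε ∧ γ (τ x) = x ∧
        ∃ L : ℝ × ℝ →L[ℝ] ℝ, HasFDerivAt τ L x ∧ L (hamField g x) = 1) ∧
      ∀ s, |s| < 2 * ε → γ s ∈ V ∧ g (γ s) = 0 ∧ HasDerivAt γ (hamField g (γ s)) s := by
  obtain ⟨l, η, δ, hδ, hx, hη⟩ := exists_level_curve hg hp hd hV
  obtain ⟨T, σ, ε, hε, hT0, hTd, hσT, hσ⟩ := exists_time_function hδ
    (fun s hs => (hη s hs).2.2.2.1) (fun s hs => (hη s hs).2.2.1)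
  have hlp : Tendsto (fun x => l (x - p)) (𝓝 p) (𝓝 0) :=
    (by fun_prop : Continuous fun x => l (x - p)).tendsto' _ _ (by simp)
  have hTl : Tendsto (fun x => |T (l (x - p))|) (𝓝 p) (𝓝 0) := by
    have h1 : Tendsto T (𝓝 0) (𝓝 0) := by
      simpa [hT0] using (hTd 0 (by simpa using hδ)).continuousAt.tendsto
    simpa using (h1.comp hlp).abs
  have hW : ∀ᶠ x in 𝓝 p, (g x = 0 → η (l (x - p)) = x) ∧ |T (l (x - p))| < ε / 2 ∧
      |l (x - p)| < δ ∧ σ (T (l (x - p))) = l (x - p) := by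
    refine hx.and ((hTl.eventually (gt_mem_nhds (by positivity))).and
      (Eventually.and ?_ (hlp.eventually hσT)))
    have h2 : Tendsto (fun x => |l (x - p)|) (𝓝 p) (𝓝 0) := by simpa using hlp.abs
    exact h2.eventually (gt_mem_nhds hδ)
  refine ⟨_, fun x => T (l (x - p)), η ∘ σ, ε / 2, hW, by positivity, ?_, fun s hs => ?_⟩
  · rintro x ⟨h1, h2, h3, h4⟩ hgx
    refine ⟨h2, (congrArg η h4).trans (h1 hgx), (l (hamField g x))⁻¹ • l, ?_, ?_⟩
    · have q := hTd _ h3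
      rw [h1 hgx] at q
      exact q.comp_hasFDerivAt x (l.hasFDerivAt.comp x ((hasFDerivAt_id x).sub_const p))
    · have := (hη _ h3.le).2.2.1
      rw [h1 hgx] at this
      simp [this.ne']
  · obtain ⟨h1, h2⟩ := hσ s (by linarith)
    obtain ⟨k1, k2, k3, -, k5⟩ := hη _ h1.le
    refine ⟨k1, k2, ?_⟩
    have := k5.scomp s h2
    rw [smul_smul, mul_inv_cancel₀ k3.ne', one_smul] at this
    exact this

/-- `z` is an integral curve of the vector field `X` on `s` which stays in `K`. -/
def IsCurveIn {E : Type*} [NormedAddCommGroup E] [NormedSpace ℝ E] (X : E → E) (K : Set E)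
    (z : ℝ → E) (s : Set ℝ) : Prop :=
  ∀ t ∈ s, z t ∈ K ∧ HasDerivAt z (X (z t)) t

/-- Around each of its points, `K` is parametrised by an integral curve `γ` of `X` that is inverse
to a time function `τ`. -/
def HasFlowBoxes {E : Type*} [NormedAddCommGroup E] [NormedSpace ℝ E] (X : E → E)
    (K : Set E) : Prop :=
  ∀ p ∈ K, ∃ (W : Set E) (τ : E → ℝ) (γ : ℝ → E) (ε : ℝ), W ∈ 𝓝 p ∧ 0 < ε ∧
    (∀ x ∈ W, x ∈ K → |τ x| < ε ∧ γ (τ x) = x ∧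
      ∃ L : E →L[ℝ] ℝ, HasFDerivAt τ L x ∧ L (X x) = 1) ∧
    IsCurveIn X K γ {s | |s| < 2 * ε}

section FlowBoxes

variable {E : Type*} [NormedAddCommGroup E] [NormedSpace ℝ E] {X : E → E} {K : Set E}

lemma IsCurveIn.mono {z : ℝ → E} {s t : Set ℝ} (h : IsCurveIn X K z t) (hst : s ⊆ t) :
    IsCurveIn X K z s :=
  fun r hr => h r (hst hr)

lemma IsCurveIn.comp_const_add {z : ℝ → E} {s : Set ℝ} (h : IsCurveIn X K z s) (c : ℝ) :
    IsCurveIn X K (fun t => z (c + t)) {t | c + t ∈ s} := fun t ht =>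
  ⟨(h _ ht).1, (h _ ht).2.comp_const_add c t⟩

lemma HasFlowBoxes.eqOn (hX : HasFlowBoxes X K) {z w : ℝ → E} {s : Set ℝ} (hs : IsOpen s)
    (hsc : IsPreconnected s) (hz : IsCurveIn X K z s) (hw : IsCurveIn X K w s) {t₀ : ℝ}
    (ht₀ : t₀ ∈ s) (h₀ : z t₀ = w t₀) : EqOn z w s := by
  have key : s ⊆ {t | ∀ᶠ r in 𝓝 t, z r = w r} := by
    have hloc : ∀ t ∈ s, z t = w t → ∀ᶠ r in 𝓝 t, z r = w r := by
      intro t ht hzw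
      obtain ⟨W, τ, γ, ε, hW, -, hτ, -⟩ := hX (z t) (hz t ht).1
      have hev : ∀ᶠ r in 𝓝 t, r ∈ s ∧ z r ∈ W ∧ w r ∈ W :=
        (hs.eventually_mem ht).and
          (((hz t ht).2.continuousAt.eventually_mem hW).and
            ((hw t ht).2.continuousAt.eventually_mem (by rwa [← hzw])))
      obtain ⟨δ, hδ, H⟩ := Metric.eventually_nhds_iff_ball.1 hev
      have hder : ∀ {y : ℝ → E}, IsCurveIn X K y s → (∀ r ∈ Metric.ball t δ, y r ∈ W) →
          ∀ r ∈ Metric.ball t δ, HasDerivAt (fun r => τ (y r)) 1 r := by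
        intro y hy hyW r hr
        obtain ⟨h1, h2⟩ := hy r (H r hr).1
        obtain ⟨-, -, L, hL, hL1⟩ := hτ _ (hyW r hr) h1
        have := hL.comp_hasDerivAt r h2
        rwa [hL1] at this
      have hzd := hder hz fun r hr => (H r hr).2.1
      have hwd := hder hw fun r hr => (H r hr).2.2
      have heq : EqOn (fun r => τ (z r)) (fun r => τ (w r)) (Metric.ball t δ) :=
        Metric.isOpen_ball.eqOn_of_deriv_eq (convex_ball t δ).isPreconnected
          (fun r hr => (hzd r hr).differentiableAt.differentiableWithinAt)
          (fun r hr => (hwd r hr).differentiableAt.differentiableWithinAt)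
          (fun r hr => (hzd r hr).deriv.trans (hwd r hr).deriv.symm)
          (Metric.mem_ball_self hδ) (by simp [hzw])
      filter_upwards [Metric.ball_mem_nhds t hδ] with r hr
      obtain ⟨h1, h2, h3⟩ := H r hr
      rw [← (hτ _ h2 (hz r h1).1).2.1, ← (hτ _ h3 (hw r h1).1).2.1]
      exact congrArg γ (heq hr)
    refine hsc.subset_of_closure_inter_subset isOpen_setOfPred_eventually_nhds
      ⟨t₀, ht₀, hloc t₀ ht₀ h₀⟩ ?_
    rintro t ⟨htc, hts⟩
    refine hloc t hts ?_
    by_contra hne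
    have hne' : ∀ᶠ r in 𝓝 t, z r ≠ w r :=
      ((hz t hts).2.continuousAt.prodMk (hw t hts).2.continuousAt).eventually
        (isClosed_diagonal.isOpen_compl.eventually_mem hne)
    obtain ⟨r, hr1, hr2⟩ := mem_closure_iff_nhds.1 htc _ hne'
    exact hr1 (show ∀ᶠ r' in 𝓝 r, z r' = w r' from hr2).self_of_nhds
  exact fun t ht => (key ht).self_of_nhds

lemma HasFlowBoxes.exists_uniform (hX : HasFlowBoxes X K) (hK : IsCompact K) :
    ∃ h > 0, ∀ p ∈ K, ∃ z : ℝ → E, z 0 = p ∧ IsCurveIn X K z (Ioo (-(2 * h)) (2 * h)) := by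
  have : ∃ h > 0, ∀ p ∈ K, p ∈ K →
      ∃ z : ℝ → E, z 0 = p ∧ IsCurveIn X K z (Ioo (-(2 * h)) (2 * h)) := by
    refine hK.induction_on (p := fun s => ∃ h > 0, ∀ p ∈ s, p ∈ K →
      ∃ z : ℝ → E, z 0 = p ∧ IsCurveIn X K z (Ioo (-(2 * h)) (2 * h)))
      ⟨1, one_pos, by simp⟩ ?_ ?_ ?_
    · rintro s t hst ⟨h, hh, H⟩
      exact ⟨h, hh, fun p hp => H p (hst hp)⟩
    · rintro s t ⟨h, hh, H⟩ ⟨h', hh', H'⟩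
      refine ⟨min h h', lt_min hh hh', fun p hp hpK => ?_⟩
      rcases hp with hp | hp
      · obtain ⟨z, hz0, hz⟩ := H p hp hpK
        refine ⟨z, hz0, hz.mono (Ioo_subset_Ioo ?_ ?_)⟩ <;> linarith [min_le_left h h']
      · obtain ⟨z, hz0, hz⟩ := H' p hp hpK
        refine ⟨z, hz0, hz.mono (Ioo_subset_Ioo ?_ ?_)⟩ <;> linarith [min_le_right h h']
    · intro p hp
      obtain ⟨W, τ, γ, ε, hW, hε, hτ, hγ⟩ := hX p hp
      refine ⟨W, mem_nhdsWithin_of_mem_nhds hW, ε / 2, by positivity, fun q hq hqK => ?_⟩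
      obtain ⟨h1, h2, -⟩ := hτ q hq hqK
      refine ⟨fun t => γ (τ q + t), by simpa using h2,
        (hγ.comp_const_add (τ q)).mono fun t ht => ?_⟩
      have := abs_lt.1 h1
      have ht' := mem_Ioo.1 ht
      show |τ q + t| < 2 * ε
      exact abs_lt.2 ⟨by linarith, by linarith⟩
  obtain ⟨h, hh, H⟩ := this
  exact ⟨h, hh, fun p hp => H p hp hp⟩

lemma HasFlowBoxes.exists_global (hX : HasFlowBoxes X K) (hK : IsCompact K) {x₀ : E}
    (hx₀ : x₀ ∈ K) : ∃ z : ℝ → E, z 0 = x₀ ∧ IsCurveIn X K z univ := by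
  obtain ⟨h, hh, H⟩ := hX.exists_uniform hK
  choose! Z hZ0 hZ using H
  have hmem : ∀ {p t}, p ∈ K → |t| ≤ h → Z p t ∈ K := fun {p t} hp ht =>
    (hZ p hp t ⟨by linarith [(abs_le.1 ht).1], by linarith [(abs_le.1 ht).2]⟩).1
  have hshift : ∀ p ∈ K, ∀ c, |c| ≤ h → ∀ t, |c + t| < 2 * h → |t| < 2 * h →
      Z p (c + t) = Z (Z p c) t := by
    intro p hp c hc t hct ht
    have h1 := ((hZ p hp).comp_const_add c).mono
      (inter_subset_left (t := Ioo (-(2 * h)) (2 * h)))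
    have h2 := (hZ _ (hmem hp hc)).mono
      (inter_subset_right (s := {t | c + t ∈ Ioo (-(2 * h)) (2 * h)}))
    have hset : {t | c + t ∈ Ioo (-(2 * h)) (2 * h)} = Ioo (-(2 * h) - c) (2 * h - c) := by
      ext t
      simp only [mem_ofPred_eq, mem_Ioo]
      constructor <;> rintro ⟨_, _⟩ <;> constructor <;> linarith
    have hc' := abs_le.1 hc
    refine hX.eqOn (t₀ := 0) ?_ ?_ h1 h2 ?_ ?_ ⟨abs_lt.1 hct, abs_lt.1 ht⟩
    · rw [hset]; exact isOpen_Ioo.inter isOpen_Ioo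
    · rw [hset, Ioo_inter_Ioo]; exact isPreconnected_Ioo
    · rw [hset]
      exact ⟨⟨by linarith, by linarith⟩, by linarith, by linarith⟩
    · simp [hZ0 _ (hmem hp hc)]
  have hh' : |h| ≤ h := (abs_of_pos hh).le
  have hnh : |(-h)| ≤ h := by rw [abs_neg]; exact hh'
  let F : Equiv.Perm K :=
    { toFun := fun p => ⟨Z p h, hmem p.2 hh'⟩
      invFun := fun p => ⟨Z p (-h), hmem p.2 hnh⟩
      left_inv := fun p => Subtype.ext <| by
        have := hshift p p.2 h hh' (-h) (by simpa using hh)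
          (by rw [abs_neg, abs_of_pos hh]; linarith)
        simpa [hZ0 _ p.2] using this.symm
      right_inv := fun p => Subtype.ext <| by
        have := hshift p p.2 (-h) hnh h (by simpa using hh)
          (by rw [abs_of_pos hh]; linarith)
        simpa [hZ0 _ p.2] using this.symm }
  let P : ℤ → K := fun n => (F ^ n) ⟨x₀, hx₀⟩
  have hP : ∀ n, (P (n + 1) : E) = Z (P n) h := fun n => by
    simp only [P]
    rw [add_comm, zpow_add, zpow_one, Equiv.Perm.mul_apply]
    rfl
  let z : ℝ → E := fun t => Z (P ⌊t / h⌋) (t - h * ⌊t / h⌋)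
  have hloc : ∀ n : ℤ, ∀ t, |t - h * n| < h → z t = Z (P n) (t - h * n) := by
    intro n t ht
    have ht' := abs_lt.1 ht
    rcases le_or_gt 0 (t - h * n) with h0 | h0
    · have hfl : ⌊t / h⌋ = n := by
        rw [Int.floor_eq_iff, le_div_iff₀ hh, div_lt_iff₀ hh]
        constructor <;> nlinarith
      simp only [z, hfl]
    · obtain ⟨m, rfl⟩ : ∃ m, n = m + 1 := ⟨n - 1, by ring⟩
      push_cast at *
      have hfl : ⌊t / h⌋ = m := by
        rw [Int.floor_eq_iff, le_div_iff₀ hh, div_lt_iff₀ hh]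
        constructor <;> nlinarith
      have e : t - h * m = h + (t - h * (m + 1)) := by ring
      simp only [z, hfl]
      rw [hP, e]
      exact hshift _ (P m).2 h hh' _ (abs_lt.2 ⟨by linarith, by linarith⟩)
        (ht.trans (by linarith))
  refine ⟨z, ?_, fun t _ => ?_⟩
  · have := hloc 0 0 (by simpa using hh)
    rw [this]
    simpa [P] using hZ0 x₀ hx₀
  · set n := ⌊t / h⌋
    have h1 : h * n ≤ t := by
      have := Int.floor_le (t / h); rw [le_div_iff₀ hh] at this; linarith
    have h2 : t < h * n + h := by
      have := Int.lt_floor_add_one (t / h); rw [div_lt_iff₀ hh] at this; linarith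
    have h3 : |t - h * n| < h := abs_lt.2 ⟨by linarith, by linarith⟩
    have h4 : z =ᶠ[𝓝 t] fun r => Z (P n) (r - h * n) := by
      have : ∀ᶠ r in 𝓝 t, |r - h * n| < h :=
        ContinuousAt.eventually_lt (by fun_prop) continuousAt_const h3
      exact this.mono fun r hr => hloc n r hr
    obtain ⟨k1, k2⟩ := hZ _ (P n).2 (t - h * n) ⟨by linarith, by linarith⟩
    rw [h4.eq_of_nhds]
    exact ⟨k1, (k2.comp_sub_const t (h * n)).congr_of_eventuallyEq h4⟩

lemma HasFlowBoxes.exists_period (hX : HasFlowBoxes X K) (hK : IsCompact K) {z : ℝ → E}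
    (hz : IsCurveIn X K z univ) : ∃ T > 0, ∀ t, z (t + T) = z t := by
  obtain ⟨p, hp, φ, hφ, hlim⟩ := hK.tendsto_subseq (x := fun n : ℕ => z n) fun n =>
    (hz n trivial).1
  obtain ⟨W, τ, γ, ε, hW, hε, hτ, hγ⟩ := hX p hp
  obtain ⟨-, -, L, hL, -⟩ := hτ p (mem_of_mem_nhds hW) hp
  have hτlim : Tendsto (fun n => τ (z (φ n))) atTop (𝓝 (τ p)) :=
    hL.continuousAt.tendsto.comp hlim
  obtain ⟨N, hN⟩ := eventually_atTop.1 ((hlim.eventually_mem hW).and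
    (hτlim.eventually_mem (Metric.ball_mem_nhds (τ p) (half_pos one_pos))))
  set a := τ (z (φ N))
  set b := τ (z (φ (N + 1)))
  obtain ⟨hW1, hd1⟩ := hN N le_rfl
  obtain ⟨hW2, hd2⟩ := hN (N + 1) N.le_succ
  have hab : b - a < 1 := by
    have h1 := abs_lt.1 (Metric.mem_ball.1 hd1)
    have h2 := abs_lt.1 (Metric.mem_ball.1 hd2)
    linarith [h1.1, h2.2]
  obtain ⟨ha1 : |a| < ε, ha2 : γ a = z (φ N), -⟩ := hτ _ hW1 (hz _ trivial).1
  obtain ⟨hb1 : |b| < ε, hb2 : γ b = z (φ (N + 1)), -⟩ := hτ _ hW2 (hz _ trivial).1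
  have hcoin : z (φ N + (b - a)) = z (φ (N + 1)) := by
    have hset : {s : ℝ | |s| < 2 * ε} = Ioo (-(2 * ε)) (2 * ε) := by
      ext s; simp only [mem_ofPred_eq, mem_Ioo, abs_lt]
    have h1 : IsCurveIn X K (fun s => z ((φ N - a) + s)) {s | |s| < 2 * ε} :=
      (hz.comp_const_add (φ N - a)).mono fun _ _ => trivial
    have h2 := hX.eqOn (t₀ := a) (by rw [hset]; exact isOpen_Ioo)
      (by rw [hset]; exact isPreconnected_Ioo) h1 hγ
      (show |a| < 2 * ε by linarith) (by simpa using ha2.symm) (x := b)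
      (show |b| < 2 * ε by linarith)
    rw [← hb2, ← h2]
    congr 1
    ring
  have hφN : (φ N : ℝ) + 1 ≤ φ (N + 1) := by
    exact_mod_cast hφ N.lt_succ_self
  refine ⟨φ (N + 1) - (φ N + (b - a)), by linarith, fun t => ?_⟩
  have h1 : IsCurveIn X K (fun t => z ((φ (N + 1) - (φ N + (b - a))) + t)) univ :=
    (hz.comp_const_add _).mono fun _ _ => trivial
  have := hX.eqOn isOpen_univ isPreconnected_univ h1 hz (mem_univ (φ N + (b - a)))
    (by rw [hcoin]; congr 1; ring) (mem_univ t)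
  rw [← this, add_comm]

end FlowBoxes

/-- A nonconstant continuous periodic function on `ℝ` has a least positive period. -/
lemma exists_least_period {E : Type*} [TopologicalSpace E] [T2Space E] {z : ℝ → E}
    (hz : Continuous z) (hper : ∃ T > 0, ∀ t, z (t + T) = z t) (hne : ∃ t, z t ≠ z 0) :
    ∃ T > 0, (∀ t, z (t + T) = z t) ∧ ∀ T' > 0, (∀ t, z (t + T') = z t) → T ≤ T' := by
  let S : AddSubgroup ℝ :=
    { carrier := {T | ∀ t, z (t + T) = z t}
      add_mem' := fun {a b} ha hb t => by rw [← add_assoc, hb, ha]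
      zero_mem' := by simp
      neg_mem' := fun {a} ha t => by
        have := ha (t + -a)
        rw [← this]; simp }
  have hS : ∀ T, T ∈ S ↔ ∀ t, z (t + T) = z t := fun T => Iff.rfl
  have hcl : IsClosed (S : Set ℝ) := by
    have : (S : Set ℝ) = ⋂ t, {T | z (t + T) = z t} := by
      ext T; simp [hS]
    rw [this]
    exact isClosed_iInter fun t => isClosed_eq (by fun_prop) continuous_const
  obtain ⟨T₀, hT₀, hT₀p⟩ := hper
  rcases S.dense_or_cyclic with hd | ⟨a, ha⟩
  · exfalso
    obtain ⟨t, ht⟩ := hne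
    apply ht
    have hu : (S : Set ℝ) = univ := by rw [← hcl.closure_eq]; exact hd.closure_eq
    have : t ∈ S := by rw [← SetLike.mem_coe, hu]; trivial
    simpa using (hS t).1 this 0
  · have hmem : ∀ T, T ∈ S ↔ ∃ n : ℤ, n • a = T := fun T => by
      rw [ha, AddSubgroup.mem_closure_singleton]
    have ha0 : a ≠ 0 := by
      rintro rfl
      obtain ⟨n, hn⟩ := (hmem T₀).1 hT₀p
      simp at hn
      linarith
    have haS : a ∈ S := (hmem a).2 ⟨1, one_zsmul a⟩
    refine ⟨|a|, abs_pos.2 ha0, ?_, fun T hT hTp => ?_⟩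
    · rcases abs_choice a with h | h <;> rw [h]
      · exact haS
      · exact S.neg_mem haS
    · obtain ⟨n, hn⟩ := (hmem T).1 hTp
      have hn0 : n ≠ 0 := by
        rintro rfl
        simp at hn
        linarith
      have h1 : (1 : ℝ) ≤ |(n : ℝ)| := by exact_mod_cast Int.one_le_abs hn0
      have h2 : T = |(n : ℝ)| * |a| := by
        rw [← abs_mul, ← zsmul_eq_mul, hn, abs_of_pos hT]
      rw [h2]
      exact le_mul_of_one_le_left (abs_nonneg a) h1

/-- There exist `T_g > 0` and a `C¹` function `z : ℝ → ℝ²` solving the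
Hamiltonian system `z₁' = -∂₂g(z)`, `z₂' = ∂₁g(z)` with `z 0 = x₀`, which is periodic
of period `T_g`, and `T_g` is the minimal (main) period. -/
theorem exists_periodic_solution_hamiltonian_system
    (D : Set (ℝ × ℝ)) (hDo : IsOpen D) (hDb : Bornology.IsBounded D)
    (hDc : IsConnected D)
    (g : ℝ × ℝ → ℝ)
    (U : Set (ℝ × ℝ)) (hUo : IsOpen U) (hDU : closure D ⊆ U)
    (hg : ContDiffOn ℝ 1 g U)
    (hpos : ∀ x ∈ frontier D, 0 < g x)
    (hgrad : ∀ x ∈ D, g x = 0 → fderiv ℝ g x ≠ 0)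
    (x₀ : ℝ × ℝ) (hx₀ : x₀ ∈ D) (hgx₀ : g x₀ = 0) :
    ∃ (Tg : ℝ) (z : ℝ → ℝ × ℝ), 0 < Tg ∧ ContDiff ℝ 1 z ∧
      (∀ t : ℝ, HasDerivAt (fun s => (z s).1) (-pd2 g (z t)) t) ∧
      (∀ t : ℝ, HasDerivAt (fun s => (z s).2) (pd1 g (z t)) t) ∧
      z 0 = x₀ ∧
      (∀ t : ℝ, z (t + Tg) = z t) ∧
      (∀ T : ℝ, 0 < T → (∀ t : ℝ, z (t + T) = z t) → Tg ≤ T) := by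
  have hgat : ∀ x ∈ D, ContDiffAt ℝ 1 g x := fun x hx =>
    hg.contDiffAt (hUo.mem_nhds (hDU (subset_closure hx)))
  set K : Set (ℝ × ℝ) := {x | x ∈ D ∧ g x = 0} with hKdef
  have hK : IsCompact K := by
    have hKeq : K = closure D ∩ g ⁻¹' {0} := by
      ext x
      refine ⟨fun hx => ⟨subset_closure hx.1, hx.2⟩, fun hx => ⟨?_, hx.2⟩⟩
      by_contra hxD
      have := hpos x (by rw [hDo.frontier_eq]; exact ⟨hx.1, hxD⟩)
      exact this.ne' hx.2
    rw [hKeq]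
    refine hDb.isCompact_closure.of_isClosed_subset ?_ inter_subset_left
    exact (hg.continuousOn.mono hDU).preimage_isClosed_of_isClosed isClosed_closure
      isClosed_singleton
  have hX : HasFlowBoxes (hamField g) K := by
    rintro p ⟨hpD, hgp⟩
    obtain ⟨W, τ, γ, ε, hW, hε, hτ, hγ⟩ :=
      exists_flow_box (hgat p hpD) hgp (hgrad p hpD hgp) (hDo.mem_nhds hpD)
    exact ⟨W, τ, γ, ε, hW, hε, fun x hx hxK => hτ x hx hxK.2,
      fun s hs => ⟨⟨(hγ s hs).1, (hγ s hs).2.1⟩, (hγ s hs).2.2⟩⟩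
  obtain ⟨z, hz0, hz⟩ := hX.exists_global hK ⟨hx₀, hgx₀⟩
  have hzK : ∀ t, z t ∈ K := fun t => (hz t trivial).1
  have hzd : ∀ t, HasDerivAt z (hamField g (z t)) t := fun t => (hz t trivial).2
  have hzc : Continuous z := continuous_iff_continuousAt.2 fun t => (hzd t).continuousAt
  have hne : ∃ t, z t ≠ z 0 := by
    by_contra! hcon
    have h1 : HasDerivAt z 0 0 := by
      rw [funext hcon]
      exact hasDerivAt_const 0 (z 0)
    exact hamField_ne_zero (hgrad _ (hzK 0).1 (hzK 0).2) ((hzd 0).unique h1)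
  obtain ⟨T, hT, hTp, hTmin⟩ := exists_least_period hzc (hX.exists_period hK hz) hne
  refine ⟨T, z, hT, ?_, fun t => (hzd t).fst, fun t => (hzd t).snd, hz0, hTp,
    fun T' hT' h => hTmin T' hT' h⟩
  rw [contDiff_one_iff_deriv]
  refine ⟨fun t => (hzd t).differentiableAt, ?_⟩
  rw [funext fun t => (hzd t).deriv, continuous_iff_continuousAt]
  exact fun t => ContinuousAt.comp' (g := hamField g) (continuousAt_hamField (hgat _ (hzK t).1))
    hzc.continuousAt
end

section
/- Under the stated hypotheses, if z₂'(T_g) ≠ 0, then the main period of the perturbed Hamiltonian system is differentiable with respect to the perturbation parameter at λ = 0, and lim_{λ→0} (T_λ − T_g)/λ = −w₂(T_g)/z₂'(T_g). -/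
open Filter Topology

open Set

/-- A `C²` function near a compact set can be replaced by a compactly supported one. -/
lemma exists_contDiff_hasCompactSupport_eventuallyEq {f : ℝ × ℝ → ℝ} {K U : Set (ℝ × ℝ)}
    (hK : IsCompact K) (hU : IsOpen U) (hKU : K ⊆ U) (hf : ContDiffOn ℝ 2 f U) :
    ∃ F : ℝ × ℝ → ℝ, ContDiff ℝ 2 F ∧ HasCompactSupport F ∧ ∀ x ∈ K, F =ᶠ[𝓝 x] f := by
  obtain ⟨L, hL, hKL, hLU⟩ := exists_compact_between hK hU hKU
  obtain ⟨χ, hχ1, hχ0, -⟩ := exists_contMDiffMap_one_nhds_of_subset_interior (n := 2)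
    (modelWithCornersSelf ℝ (ℝ × ℝ)) hK.isClosed hKL
  have hχ : ContDiff ℝ 2 χ := χ.contMDiff.contDiff
  have hts : tsupport χ ⊆ L := closure_minimal
    (fun x hx => by_contra fun h => hx (hχ0 x h)) hL.isClosed
  refine ⟨fun x => χ x * f x, ?_, ?_, fun x hx => ?_⟩
  · rw [contDiff_iff_contDiffAt]
    intro x
    by_cases hx : x ∈ U
    · exact hχ.contDiffAt.mul (hf.contDiffAt (hU.mem_nhds hx))
    · have : (fun x => χ x * f x) =ᶠ[𝓝 x] fun _ => 0 := by
        filter_upwards [(isClosed_tsupport χ).isOpen_compl.mem_nhds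
          (fun h => hx (hLU (hts h)))] with y hy
        rw [image_eq_zero_of_notMem_tsupport hy, zero_mul]
      exact contDiffAt_const.congr_of_eventuallyEq this
  · exact (HasCompactSupport.of_support_subset_isCompact hL
      (subset_closure.trans hts)).mul_right
  · filter_upwards [(eventually_nhdsSet_iff_forall.1 hχ1) x hx] with y hy
    rw [hy, one_mul]

section ODE

variable {E : Type*} [NormedAddCommGroup E] [NormedSpace ℝ E]

lemma gronwallBound_zero_mul (K c ε x : ℝ) :
    gronwallBound 0 K (c * ε) x = c * gronwallBound 0 K ε x := by
  unfold gronwallBound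
  split_ifs <;> ring

lemma tendsto_gronwallBound_zero (K x : ℝ) :
    Tendsto (fun ε => gronwallBound 0 K ε x) (𝓝 0) (𝓝 0) := by
  simpa [gronwallBound_ε0_δ0] using (gronwallBound_continuous_ε 0 K x).tendsto 0

/-- Solutions of a perturbed autonomous equation are uniformly close to the unperturbed one. -/
lemma eventually_forall_dist_lt_of_perturbed {F P : E → E} {K : NNReal}
    (hF : LipschitzWith K F) {M : ℝ} (hP : ∀ x, ‖P x‖ ≤ M) {z : ℝ → E} {y : ℝ → ℝ → E}
    (hz : ∀ t, HasDerivAt z (F (z t)) t)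
    (hy : ∀ᶠ l in 𝓝[≠] (0 : ℝ), ∀ t, HasDerivAt (y l) (F (y l t) + l • P (y l t)) t)
    (hy0 : ∀ᶠ l in 𝓝[≠] (0 : ℝ), y l 0 = z 0) (S : ℝ) {δ : ℝ} (hδ : 0 < δ) :
    ∀ᶠ l in 𝓝[≠] (0 : ℝ), ∀ t ∈ Icc 0 S, dist (y l t) (z t) < δ := by
  have hlim : Tendsto (fun l : ℝ => gronwallBound 0 K (|l| * M) S) (𝓝[≠] 0) (𝓝 0) := by
    refine (tendsto_gronwallBound_zero K S).comp (Tendsto.mono_left ?_ nhdsWithin_le_nhds)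
    exact (by fun_prop : Continuous fun l : ℝ => |l| * M).tendsto' 0 0 (by simp)
  have hM : 0 ≤ M := (norm_nonneg _).trans (hP (z 0))
  filter_upwards [hy, hy0, hlim.eventually_lt_const hδ] with l h h0 hl t ht
  have := dist_le_of_approx_trajectories_ODE (v := fun _ => F) (a := 0) (b := S)
    (εf := |l| * M) (εg := 0) (δ := 0) (fun _ => hF)
    (continuous_iff_continuousAt.2 fun t => (h t).continuousAt).continuousOn
    (fun t _ => (h t).hasDerivWithinAt)
    (fun t _ => by
      rw [dist_eq_norm, add_sub_cancel_left, norm_smul, Real.norm_eq_abs]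
      exact mul_le_mul_of_nonneg_left (hP _) (abs_nonneg _))
    (continuous_iff_continuousAt.2 fun t => (hz t).continuousAt).continuousOn
    (fun t _ => (hz t).hasDerivWithinAt) (fun t _ => by simp) (by simp [h0]) t ht
  rw [add_zero, sub_zero] at this
  exact (this.trans (gronwallBound_mono le_rfl (by positivity) K.2 ht.2)).trans_lt hl

/-- First-order Taylor expansion, uniform in the base point, for a map with uniformly continuous
derivative. -/
lemma exists_forall_norm_taylor_le {F : E → E} (hF : Differentiable ℝ F)
    (hF' : UniformContinuous (fderiv ℝ F)) {η : ℝ} (hη : 0 < η) :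
    ∃ ρ > 0, ∀ x v : E, ‖v‖ < ρ → ‖F (x + v) - F x - fderiv ℝ F x v‖ ≤ η * ‖v‖ := by
  obtain ⟨ρ, hρ, h⟩ := Metric.uniformContinuous_iff.1 hF' η hη
  refine ⟨ρ, hρ, fun x v hv => ?_⟩
  have := (convex_ball x ρ).norm_image_sub_le_of_norm_fderiv_le' (𝕜 := ℝ) (f := F)
    (φ := fderiv ℝ F x) (C := η) (x := x) (y := x + v) (fun y _ => hF y)
    (fun y hy => by rw [← dist_eq_norm]; exact (h hy).le)
    (Metric.mem_ball_self hρ) (by simpa using hv)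
  simpa using this

/-- Differentiability of the solution of `y' = F y + l P y` with respect to `l` at `l = 0`, with
derivative solving the equation in variations. -/
lemma tendsto_inv_smul_sub_of_variation {F P : E → E} {K K' : NNReal}
    (hF : LipschitzWith K F) (hP : LipschitzWith K' P) (hFd : Differentiable ℝ F)
    (hF' : UniformContinuous (fderiv ℝ F)) {z w : ℝ → E} {y : ℝ → ℝ → E}
    (hz : ∀ t, HasDerivAt z (F (z t)) t)
    (hy : ∀ᶠ l in 𝓝[≠] (0 : ℝ), ∀ t, HasDerivAt (y l) (F (y l t) + l • P (y l t)) t)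
    (hy0 : ∀ᶠ l in 𝓝[≠] (0 : ℝ), y l 0 = z 0) {S : ℝ} (hS : 0 ≤ S) (hw0 : w 0 = 0)
    (hw : ∀ t ∈ Icc 0 S, HasDerivWithinAt w (fderiv ℝ F (z t) (w t) + P (z t)) (Icc 0 S) t) :
    Tendsto (fun l => l⁻¹ • (y l S - z S)) (𝓝[≠] (0 : ℝ)) (𝓝 (w S)) := by
  have hwc : ContinuousOn w (Icc 0 S) := fun t ht => (hw t ht).continuousWithinAt
  obtain ⟨W₀, hW₀⟩ := isCompact_Icc.exists_bound_of_continuousOn hwc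
  obtain ⟨W, hWpos, hW⟩ : ∃ W > 0, ∀ t ∈ Icc 0 S, ‖w t‖ ≤ W :=
    ⟨max W₀ 1, by positivity, fun t ht => (hW₀ t ht).trans (le_max_left _ _)⟩
  have hzc : Continuous z := continuous_iff_continuousAt.2 fun t => (hz t).continuousAt
  rw [Metric.tendsto_nhds]
  intro ε hε
  obtain ⟨η, hηε, hη⟩ := (((tendsto_gronwallBound_zero (K + K' : NNReal) S).mono_left
    (nhdsWithin_le_nhds (s := Ioi 0))).eventually_lt_const hε |>.and self_mem_nhdsWithin).exists
  replace hη : 0 < η := hη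
  obtain ⟨ρ, hρ, hT⟩ := exists_forall_norm_taylor_le hFd hF' (η := η / (2 * W)) (by positivity)
  have hsmall : ∀ᶠ l in 𝓝[≠] (0 : ℝ), |l| ≤ 1 ∧ |l| * W < ρ ∧ K' * (|l| * W) < η / 2 := by
    refine Filter.Eventually.filter_mono nhdsWithin_le_nhds ?_
    have h0 : Tendsto (fun l : ℝ => |l|) (𝓝 0) (𝓝 0) := continuous_abs.tendsto' 0 0 (by simp)
    refine (h0.eventually_le_const one_pos).and ((Tendsto.eventually_lt_const hρ ?_).and
      (Tendsto.eventually_lt_const (half_pos hη) ?_))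
    · simpa using h0.mul_const W
    · simpa using (h0.mul_const W).const_mul (K' : ℝ)
  filter_upwards [hy, hy0, hsmall, self_mem_nhdsWithin] with l h h0 ⟨hl1, hlρ, hlη⟩ hl
  have hlip : LipschitzWith (K + K') fun x => F x + l • P x := by
    refine LipschitzWith.of_dist_le_mul fun a b => ?_
    have h1 := hF.dist_le_mul a b
    have h2 := hP.dist_le_mul a b
    calc dist (F a + l • P a) (F b + l • P b)
        ≤ dist (F a) (F b) + dist (l • P a) (l • P b) := dist_add_add_le _ _ _ _
      _ ≤ K * dist a b + 1 * (K' * dist a b) := by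
        rw [dist_smul₀, Real.norm_eq_abs]; gcongr
      _ = _ := by push_cast; ring
  have key := dist_le_of_approx_trajectories_ODE (v := fun _ x => F x + l • P x)
    (f := y l) (g := fun t => z t + l • w t) (f' := fun t => F (y l t) + l • P (y l t))
    (g' := fun t => F (z t) + l • (fderiv ℝ F (z t) (w t) + P (z t)))
    (a := 0) (b := S) (εf := 0) (εg := |l| * η) (δ := 0) (fun _ => hlip)
    (continuous_iff_continuousAt.2 fun t => (h t).continuousAt).continuousOn
    (fun t _ => (h t).hasDerivWithinAt) (fun t _ => by simp)
    (hzc.continuousOn.add (hwc.const_smul l))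
    (fun t ht => (hz t).hasDerivWithinAt.add
      (((hw t (Ico_subset_Icc_self ht)).mono_of_mem_nhdsWithin
        (Icc_mem_nhdsGE_of_mem ht)).const_smul l))
    (fun t ht => by
      have hwt := hW t (Ico_subset_Icc_self ht)
      have hlw : ‖l • w t‖ ≤ |l| * W := by
        rw [norm_smul, Real.norm_eq_abs]; gcongr
      have h1 := hT (z t) (l • w t) (hlw.trans_lt hlρ)
      have h2 := hP.dist_le_mul (z t + l • w t) (z t)
      rw [dist_eq_norm, dist_eq_norm, add_sub_cancel_left] at h2
      have e : F (z t) + l • (fderiv ℝ F (z t) (w t) + P (z t)) -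
          (F (z t + l • w t) + l • P (z t + l • w t)) =
          -((F (z t + l • w t) - F (z t) - fderiv ℝ F (z t) (l • w t)) +
            l • (P (z t + l • w t) - P (z t))) := by
        rw [map_smul]; module
      rw [dist_eq_norm, e, norm_neg]
      calc _ ≤ η / (2 * W) * (|l| * W) + |l| * (K' * (|l| * W)) := by
            refine (norm_add_le _ _).trans (add_le_add (h1.trans (by gcongr)) ?_)
            rw [norm_smul, Real.norm_eq_abs]
            gcongr
            exact h2.trans (by gcongr)
        _ ≤ η / (2 * W) * (|l| * W) + |l| * (η / 2) := by gcongr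
        _ = |l| * η := by field_simp; ring)
    (by simp [h0, hw0]) S ⟨hS, le_rfl⟩
  rw [zero_add, sub_zero, gronwallBound_zero_mul, dist_eq_norm] at key
  have hl0 : 0 < |l| := abs_pos.2 hl
  have e : l⁻¹ • (y l S - z S) - w S = l⁻¹ • (y l S - (z S + l • w S)) := by
    rw [← sub_sub, smul_sub l⁻¹ (y l S - z S), inv_smul_smul₀ hl]
  rw [dist_eq_norm, e, norm_smul, norm_inv, Real.norm_eq_abs, inv_mul_lt_iff₀ hl0]
  exact key.trans_lt (by gcongr)

/-- A solution of an autonomous Lipschitz equation that returns to its initial value is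
periodic. -/
lemma periodic_of_eq_zero_time {F : E → E} {K : NNReal} (hF : LipschitzWith K F) {z : ℝ → E}
    (hz : ∀ t, HasDerivAt z (F (z t)) t) {τ : ℝ} (hτ : z τ = z 0) (t : ℝ) :
    z (t + τ) = z t :=
  congrFun (ODE_solution_unique_univ (v := fun _ => F) (s := fun _ => univ) (t₀ := 0)
    (f := fun t => z (t + τ)) (fun _ => hF.lipschitzOnWith)
    (fun t => ⟨(hz (t + τ)).comp_add_const t τ, trivial⟩) (fun t => ⟨hz t, trivial⟩)
    (by simpa using hτ)) t

end ODE

/-- A conserved quantity that takes a different value on the frontier of `D` confines a curve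
to `D`. -/
lemma forall_mem_of_deriv_comp_eq_zero {D : Set (ℝ × ℝ)} (hD : IsOpen D) {h : ℝ × ℝ → ℝ}
    (hh : ContinuousOn h (closure D)) {z : ℝ → ℝ × ℝ} (hz : Continuous z)
    (hz0 : z 0 ∈ D) (hd : ∀ t, z t ∈ D → HasDerivAt (fun s => h (z s)) 0 t)
    (hfr : ∀ x ∈ frontier D, h x ≠ h (z 0)) (t : ℝ) : z t ∈ D := by
  set A : Set ℝ := z ⁻¹' D ∩ (fun s => h (z s)) ⁻¹' {h (z 0)} with hA
  have hopen : IsOpen A := (hD.preimage hz).isOpen_inter_preimage_of_deriv_eq_zero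
    (fun s hs => (hd s hs).differentiableAt.differentiableWithinAt) (fun s hs => (hd s hs).deriv) _
  have hA' : A = z ⁻¹' closure D ∩ (fun s => h (z s)) ⁻¹' {h (z 0)} := by
    ext s
    refine ⟨fun hs => ⟨subset_closure hs.1, hs.2⟩, fun hs => ⟨?_, hs.2⟩⟩
    by_contra hsD
    exact hfr (z s) (hD.frontier_eq ▸ ⟨hs.1, hsD⟩) hs.2
  have hclosed : IsClosed A := by
    rw [hA']
    exact (hh.comp hz.continuousOn (mapsTo_preimage _ _)).preimage_isClosed_of_isClosed
      (isClosed_closure.preimage hz) isClosed_singleton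
  have : A = univ := IsClopen.eq_univ ⟨hclosed, hopen⟩ ⟨0, hz0, rfl⟩
  exact (this ▸ mem_univ t : t ∈ A).1

/-- The Hamiltonian vector field of `h`. -/
noncomputable def hamiltonianField (h : ℝ × ℝ → ℝ) (x : ℝ × ℝ) : ℝ × ℝ := (-pd2 h x, pd1 h x)

section Hamiltonian

variable {h h' : ℝ × ℝ → ℝ} {x : ℝ × ℝ}

lemma pd1_congr (e : h =ᶠ[𝓝 x] h') : pd1 h =ᶠ[𝓝 x] pd1 h' :=
  (e.fderiv (𝕜 := ℝ)).mono fun y hy => by simp only [pd1, hy]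

lemma pd2_congr (e : h =ᶠ[𝓝 x] h') : pd2 h =ᶠ[𝓝 x] pd2 h' :=
  (e.fderiv (𝕜 := ℝ)).mono fun y hy => by simp only [pd2, hy]

lemma ContDiff.pd1 (hh : ContDiff ℝ 2 h) : ContDiff ℝ 1 (pd1 h) :=
  (hh.fderiv_right (m := 1) (by norm_num)).clm_apply contDiff_const

lemma ContDiff.pd2 (hh : ContDiff ℝ 2 h) : ContDiff ℝ 1 (pd2 h) :=
  (hh.fderiv_right (m := 1) (by norm_num)).clm_apply contDiff_const

lemma ContDiff.hamiltonianField (hh : ContDiff ℝ 2 h) : ContDiff ℝ 1 (hamiltonianField h) :=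
  hh.pd2.neg.prodMk hh.pd1

lemma HasCompactSupport.hamiltonianField (hh : HasCompactSupport h) :
    HasCompactSupport (hamiltonianField h) :=
  (hh.fderiv (𝕜 := ℝ)).comp_left (g := fun L : ℝ × ℝ →L[ℝ] ℝ => (-L (0, 1), L (1, 0))) (by simp)

lemma fderiv_apply_eq_pd (h : ℝ × ℝ → ℝ) (x v : ℝ × ℝ) :
    fderiv ℝ h x v = pd1 h x * v.1 + pd2 h x * v.2 := by
  have : v = v.1 • (1, 0) + v.2 • ((0, 1) : ℝ × ℝ) := by ext <;> simp
  conv_lhs => rw [this, map_add, map_smul, map_smul]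
  simp [pd1, pd2, mul_comm]

lemma pd1_add_mul (hh : DifferentiableAt ℝ h x) (hh' : DifferentiableAt ℝ h' x) (l : ℝ) :
    pd1 (fun y => h y + l * h' y) x = pd1 h x + l * pd1 h' x := by
  simp [pd1, fderiv_fun_add hh (hh'.const_mul l), fderiv_const_mul hh']

lemma pd2_add_mul (hh : DifferentiableAt ℝ h x) (hh' : DifferentiableAt ℝ h' x) (l : ℝ) :
    pd2 (fun y => h y + l * h' y) x = pd2 h x + l * pd2 h' x := by
  simp [pd2, fderiv_fun_add hh (hh'.const_mul l), fderiv_const_mul hh']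

lemma hamiltonianField_add_mul (hh : DifferentiableAt ℝ h x) (hh' : DifferentiableAt ℝ h' x)
    (l : ℝ) : hamiltonianField (fun y => h y + l * h' y) x =
      hamiltonianField h x + l • hamiltonianField h' x := by
  simp only [hamiltonianField, pd1_add_mul hh hh', pd2_add_mul hh hh']
  ext
  · simp; ring
  · simp

/-- The Hamiltonian is conserved along its flow. -/
lemma hasDerivAt_hamiltonian_comp {z : ℝ → ℝ × ℝ} {t : ℝ}
    (hz : HasDerivAt z (hamiltonianField h (z t)) t) (hh : DifferentiableAt ℝ h (z t)) :
    HasDerivAt (fun s => h (z s)) 0 t := by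
  have := hh.hasFDerivAt.comp_hasDerivAt t hz
  rwa [fderiv_apply_eq_pd, hamiltonianField, mul_neg, mul_comm (pd1 h _), neg_add_cancel] at this

lemma fderiv_hamiltonianField_apply (hh : ContDiff ℝ 2 h) (x v : ℝ × ℝ) :
    fderiv ℝ (hamiltonianField h) x v =
      (-(pd1 (pd2 h) x * v.1 + pd2 (pd2 h) x * v.2), pd1 (pd1 h) x * v.1 + pd2 (pd1 h) x * v.2) := by
  have h1 := (hh.pd1.differentiable one_ne_zero x).hasFDerivAt
  have h2 := (hh.pd2.differentiable one_ne_zero x).hasFDerivAt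
  have : HasFDerivAt (hamiltonianField h) _ x := h2.neg.prodMk h1
  rw [this.fderiv, ← fderiv_apply_eq_pd, ← fderiv_apply_eq_pd]
  rfl

/-- If `∂₁h` has the sign of `a` on a ball around `c`, a point of the ball on the same level and
the same horizontal line as `c` is `c`. -/
lemma eq_center_of_pd1_pos {c : ℝ × ℝ} {a ρ : ℝ} (hh : Differentiable ℝ h)
    (ha : ∀ y ∈ Metric.ball c ρ, 0 < a * pd1 h y) (hx : x ∈ Metric.ball c ρ)
    (hlev : h x = h c) (hx2 : x.2 = c.2) : x = c := by
  have hd : ∀ s, HasDerivAt (fun s => a * h (s, c.2)) (a * pd1 h (s, c.2)) s := fun s =>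
    ((hh (s, c.2)).hasFDerivAt.comp_hasDerivAt s
      ((hasDerivAt_id s).prodMk (hasDerivAt_const s c.2))).const_mul a
  have hmem : ∀ s ∈ Metric.ball c.1 ρ, (s, c.2) ∈ Metric.ball c ρ := fun s hs => by
    rw [Metric.mem_ball, Prod.dist_eq, dist_self]
    exact max_lt hs (Metric.pos_of_mem_ball hs)
  have hmono : StrictMonoOn (fun s => a * h (s, c.2)) (Metric.ball c.1 ρ) :=
    strictMonoOn_of_deriv_pos (convex_ball _ _)
      (fun s _ => (hd s).continuousAt.continuousWithinAt)
      fun s hs => by rw [(hd s).deriv]; exact ha _ (hmem s (interior_subset hs))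
  have hρ := Metric.pos_of_mem_ball hx
  have hx1 : x.1 ∈ Metric.ball c.1 ρ := by
    rw [Metric.mem_ball, Prod.dist_eq] at hx
    exact (le_max_left _ _).trans_lt hx
  refine Prod.ext (hmono.injOn hx1 (Metric.mem_ball_self hρ) ?_) hx2
  simp only [← hx2]
  rw [hx2, Prod.mk.eta, ← hlev, ← hx2]

/-- Along a piece of trajectory where `∂₁h` has the sign of `a`, `a` times the second coordinate
increases. -/
lemma strictMonoOn_snd_of_pd1_pos {z : ℝ → ℝ × ℝ} {a : ℝ} {I : Set ℝ} (hI : Convex ℝ I)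
    (hz : ∀ t, HasDerivAt z (hamiltonianField h (z t)) t) (ha : ∀ t ∈ I, 0 < a * pd1 h (z t)) :
    StrictMonoOn (fun t => a * (z t).2) I := by
  have hd : ∀ t, HasDerivAt (fun t => a * (z t).2) (a * pd1 h (z t)) t := fun t =>
    ((hasFDerivAt_snd (𝕜 := ℝ) (p := z t)).comp_hasDerivAt t (hz t)).const_mul a
  exact strictMonoOn_of_deriv_pos hI (fun t _ => (hd t).continuousAt.continuousWithinAt)
    fun t ht => by rw [(hd t).deriv]; exact ha t (interior_subset ht)

end Hamiltonian

section Period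

variable {G R : ℝ × ℝ → ℝ} {z : ℝ → ℝ × ℝ} {y : ℝ → ℝ → ℝ × ℝ} {Tg : ℝ} {T : ℝ → ℝ}

/-- Main periods of perturbed Hamiltonian systems converge to the unperturbed main period. -/
lemma tendsto_mainPeriod (hG : ContDiff ℝ 2 G) (hGc : HasCompactSupport G)
    (hR : ContDiff ℝ 2 R) (hRc : HasCompactSupport R)
    (hz : ∀ t, HasDerivAt z (hamiltonianField G (z t)) t) (hTg : 0 < Tg) (hper : z Tg = z 0)
    (hmin : ∀ S, 0 < S → (∀ t, z (t + S) = z t) → Tg ≤ S)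
    (hy : ∀ᶠ l in 𝓝[≠] (0 : ℝ),
      ∀ t, HasDerivAt (y l) (hamiltonianField (fun x => G x + l * R x) (y l t)) t)
    (hy0 : ∀ᶠ l in 𝓝[≠] (0 : ℝ), y l 0 = z 0)
    (hclose : ∀ δ > 0, ∀ᶠ l in 𝓝[≠] (0 : ℝ), ∀ t ∈ Icc 0 (Tg + 1), dist (y l t) (z t) < δ)
    (hTpos : ∀ᶠ l in 𝓝[≠] (0 : ℝ), 0 < T l)
    (hTper : ∀ᶠ l in 𝓝[≠] (0 : ℝ), y l (T l) = z 0)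
    (hTmin : ∀ᶠ l in 𝓝[≠] (0 : ℝ), ∀ S, 0 < S → (∀ t, y l (t + S) = y l t) → T l ≤ S)
    (ha : pd1 G (z 0) ≠ 0) :
    Tendsto T (𝓝[≠] 0) (𝓝 Tg) := by
  set a := pd1 G (z 0) with hadef
  have hGd : Differentiable ℝ G := hG.differentiable two_ne_zero
  have hRd : Differentiable ℝ R := hR.differentiable two_ne_zero
  have hzc : Continuous z := continuous_iff_continuousAt.2 fun t => (hz t).continuousAt
  obtain ⟨K, hK⟩ := hG.hamiltonianField.lipschitzWith_of_hasCompactSupport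
    hGc.hamiltonianField one_ne_zero
  obtain ⟨ρ, hρ, hpos⟩ : ∃ ρ > 0, ∀ l : ℝ, |l| < ρ → ∀ x ∈ Metric.ball (z 0) ρ,
      0 < a * pd1 (fun x => G x + l * R x) x := by
    have hcont : Continuous fun q : ℝ × (ℝ × ℝ) => a * (pd1 G q.2 + q.1 * pd1 R q.2) := by
      have := hG.pd1.continuous
      have := hR.pd1.continuous
      fun_prop
    obtain ⟨ρ, hρ, h⟩ := Metric.eventually_nhds_iff.1
      ((hcont.tendsto ((0 : ℝ), z 0)).eventually_const_lt (u := 0)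
        (by simpa only [zero_mul, add_zero, ← hadef] using mul_self_pos.2 ha))
    refine ⟨ρ, hρ, fun l hl x hx => ?_⟩
    rw [pd1_add_mul (hGd x) (hRd x)]
    exact h (y := (l, x)) (max_lt (by simpa using hl) hx)
  have hposG : ∀ x ∈ Metric.ball (z 0) ρ, 0 < a * pd1 G x := by
    simpa using hpos 0 (by simpa using hρ)
  have hb : z 0 ∈ Metric.ball (z 0) (ρ / 2) := Metric.mem_ball_self (half_pos hρ)
  obtain ⟨δ₁, hδ₁, h₁⟩ := Metric.eventually_nhds_iff.1
    (hzc.continuousAt.eventually_mem (Metric.isOpen_ball.mem_nhds hb))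
  obtain ⟨δ₂, hδ₂, h₂⟩ := Metric.eventually_nhds_iff.1
    (hzc.continuousAt.eventually_mem (x := Tg) (Metric.isOpen_ball.mem_nhds (hper ▸ hb)))
  rw [Metric.tendsto_nhds]
  intro ε hε
  obtain ⟨δ, hδ, hδε, hδ1, hδ2, hδT, hδone⟩ :
      ∃ δ > 0, δ ≤ ε ∧ δ < δ₁ ∧ δ < δ₂ ∧ δ < Tg ∧ δ < 1 := by
    obtain ⟨δ, h0, h⟩ := exists_between
      (show 0 < min ε (min δ₁ (min δ₂ (min Tg 1))) by positivity)
    simp only [lt_min_iff] at h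
    exact ⟨δ, h0, h.1.le, h.2.1, h.2.2.1, h.2.2.2.1, h.2.2.2.2⟩
  have hzstart : ∀ t ∈ Icc 0 δ, z t ∈ Metric.ball (z 0) (ρ / 2) := fun t ht => h₁ (by
    rw [Real.dist_eq, abs_lt]; constructor <;> linarith [ht.1, ht.2])
  have hzend : ∀ t ∈ Icc (Tg - δ) (Tg + δ), z t ∈ Metric.ball (z 0) (ρ / 2) := fun t ht =>
    hper ▸ h₂ (y := t) (by rw [Real.dist_eq, abs_lt]; constructor <;> linarith [ht.1, ht.2])
  obtain ⟨m, hm, hmid⟩ : ∃ m > 0, ∀ t ∈ Icc δ (Tg - δ), m ≤ dist (z t) (z 0) := by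
    rcases (Icc δ (Tg - δ)).eq_empty_or_nonempty with he | hne
    · exact ⟨1, one_pos, by simp [he]⟩
    obtain ⟨t, ht, htmin⟩ := isCompact_Icc.exists_isMinOn hne
      (f := fun t => dist (z t) (z 0)) (by fun_prop)
    refine ⟨dist (z t) (z 0), dist_pos.2 fun h => ?_, fun s hs => htmin hs⟩
    have := hmin t (hδ.trans_le ht.1) (periodic_of_eq_zero_time hK hz h)
    linarith [ht.2]
  have hmonoz := strictMonoOn_snd_of_pd1_pos (convex_Icc (Tg - δ) (Tg + δ)) hz
    fun t ht => hposG _ (Metric.ball_subset_ball (by linarith) (hzend t ht))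
  have hlow : a * (z (Tg - δ)).2 < a * (z 0).2 := hper ▸
    hmonoz (by constructor <;> linarith) (by constructor <;> linarith) (by linarith)
  have hhigh : a * (z 0).2 < a * (z (Tg + δ)).2 := hper ▸
    hmonoz (by constructor <;> linarith) (by constructor <;> linarith) (by linarith)
  have hconv : ∀ t ∈ Icc 0 (Tg + 1), Tendsto (fun l => a * (y l t).2) (𝓝[≠] 0)
      (𝓝 (a * (z t).2)) := fun t ht => by
    have : Tendsto (fun l => y l t) (𝓝[≠] 0) (𝓝 (z t)) :=
      Metric.tendsto_nhds.2 fun δ hδ => (hclose δ hδ).mono fun l hl => hl t ht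
    exact ((continuous_snd.tendsto _).comp this).const_mul a
  have hlsmall : ∀ᶠ l in 𝓝[≠] (0 : ℝ), |l| < ρ :=
    (continuous_abs.tendsto' (0 : ℝ) 0 (by simp)).mono_left nhdsWithin_le_nhds
      |>.eventually_lt_const hρ
  filter_upwards [hy, hy0, hclose _ (half_pos hρ), hclose m hm, hTpos, hTper, hTmin, hlsmall,
    (hconv (Tg - δ) (by constructor <;> linarith)).eventually_lt_const hlow,
    (hconv (Tg + δ) (by constructor <;> linarith)).eventually_const_lt hhigh]
    with l hyl hyl0 hclρ hclm hTl hTperl hTminl hlρ hlowl hhighl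
  have hnear : ∀ t ∈ Icc 0 (Tg + 1), z t ∈ Metric.ball (z 0) (ρ / 2) →
      y l t ∈ Metric.ball (z 0) ρ := fun t ht hzt => by
    have := hclρ t ht
    have := dist_triangle (y l t) (z t) (z 0)
    rw [Metric.mem_ball] at hzt ⊢
    linarith
  have hyc : Continuous (y l) := continuous_iff_continuousAt.2 fun t => (hyl t).continuousAt
  have hld : Differentiable ℝ fun x => G x + l * R x := by fun_prop
  obtain ⟨τ, hτ, hyτ⟩ : ∃ τ ∈ Ioo (Tg - δ) (Tg + δ), y l τ = z 0 := by
    obtain ⟨τ, hτ, hτ2⟩ := intermediate_value_Ioo (by linarith)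
      (f := fun t => a * (y l t).2) (by fun_prop) ⟨hlowl, hhighl⟩
    refine ⟨τ, hτ, eq_center_of_pd1_pos hld (hpos l hlρ) (hnear τ
      (by constructor <;> linarith [hτ.1, hτ.2]) (hzend τ (Ioo_subset_Icc_self hτ))) ?_
      (mul_left_cancel₀ ha hτ2)⟩
    have hd : ∀ t, HasDerivAt (fun t => G (y l t) + l * R (y l t)) 0 t := fun t =>
      hasDerivAt_hamiltonian_comp (hyl t) (hld _)
    have := is_const_of_deriv_eq_zero (fun t => (hd t).differentiableAt)
      (fun t => (hd t).deriv) τ 0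
    rwa [hyl0] at this
  have hle : T l ≤ τ := by
    obtain ⟨K', hK'⟩ := hR.hamiltonianField.lipschitzWith_of_hasCompactSupport
      hRc.hamiltonianField one_ne_zero
    have hlip := hK.add ((lipschitzWith_smul l).comp hK')
    refine hTminl τ (by linarith [hτ.1]) (periodic_of_eq_zero_time hlip (fun t => ?_)
      (hyτ.trans hyl0.symm))
    have := hyl t
    rwa [hamiltonianField_add_mul (hGd _) (hRd _)] at this
  have hgt : Tg - δ < T l := by
    by_contra! hcon
    have hT1 : T l ∈ Icc 0 (Tg + 1) := ⟨hTl.le, by linarith⟩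
    rcases le_or_gt (T l) δ with hs | hs
    · have hmono := strictMonoOn_snd_of_pd1_pos (convex_Icc 0 δ) hyl
        fun t ht => hpos l hlρ _ (hnear t ⟨ht.1, by linarith [ht.2]⟩ (hzstart t ht))
      have := hmono ⟨le_rfl, hδ.le⟩ ⟨hTl.le, hs⟩ hTl
      simp [hTperl, hyl0] at this
    · have h1 := hmid (T l) ⟨hs.le, hcon⟩
      have h2 := hclm (T l) hT1
      rw [hTperl, dist_comm] at h2
      linarith
  rw [Real.dist_eq, abs_lt]
  constructor <;> linarith [hτ.2]

/-- The derivative of the main period with respect to the perturbation parameter, for compactly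
supported Hamiltonians. -/
lemma tendsto_mainPeriod_slope (hG : ContDiff ℝ 2 G) (hGc : HasCompactSupport G)
    (hR : ContDiff ℝ 2 R) (hRc : HasCompactSupport R)
    (hz : ∀ t, HasDerivAt z (hamiltonianField G (z t)) t) (hTg : 0 < Tg) (hper : z Tg = z 0)
    (hmin : ∀ S, 0 < S → (∀ t, z (t + S) = z t) → Tg ≤ S)
    (hy : ∀ᶠ l in 𝓝[≠] (0 : ℝ),
      ∀ t, HasDerivAt (y l) (hamiltonianField (fun x => G x + l * R x) (y l t)) t)
    (hy0 : ∀ᶠ l in 𝓝[≠] (0 : ℝ), y l 0 = z 0)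
    (hTpos : ∀ᶠ l in 𝓝[≠] (0 : ℝ), 0 < T l)
    (hTper : ∀ᶠ l in 𝓝[≠] (0 : ℝ), y l (T l) = z 0)
    (hTmin : ∀ᶠ l in 𝓝[≠] (0 : ℝ), ∀ S, 0 < S → (∀ t, y l (t + S) = y l t) → T l ≤ S)
    {w : ℝ → ℝ × ℝ} (hw0 : w 0 = 0)
    (hw : ∀ t ∈ Icc 0 Tg, HasDerivWithinAt w
      (fderiv ℝ (hamiltonianField G) (z t) (w t) + hamiltonianField R (z t)) (Icc 0 Tg) t)
    (ha : pd1 G (z Tg) ≠ 0) :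
    Tendsto (fun l => (T l - Tg) / l) (𝓝[≠] 0) (𝓝 (-(w Tg).2 / pd1 G (z Tg))) := by
  have hGd : Differentiable ℝ G := hG.differentiable two_ne_zero
  have hRd : Differentiable ℝ R := hR.differentiable two_ne_zero
  have hzc : Continuous z := continuous_iff_continuousAt.2 fun t => (hz t).continuousAt
  obtain ⟨K, hK⟩ := hG.hamiltonianField.lipschitzWith_of_hasCompactSupport
    hGc.hamiltonianField one_ne_zero
  obtain ⟨K', hK'⟩ := hR.hamiltonianField.lipschitzWith_of_hasCompactSupport
    hRc.hamiltonianField one_ne_zero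
  obtain ⟨M, hM⟩ := hRc.hamiltonianField.exists_bound_of_continuous hR.hamiltonianField.continuous
  have hy' : ∀ᶠ l in 𝓝[≠] (0 : ℝ), ∀ t,
      HasDerivAt (y l) (hamiltonianField G (y l t) + l • hamiltonianField R (y l t)) t :=
    hy.mono fun l hl t => by
      rw [← hamiltonianField_add_mul (hGd _) (hRd _)]; exact hl t
  have hclose : ∀ δ > 0, ∀ᶠ l in 𝓝[≠] (0 : ℝ), ∀ t ∈ Icc 0 (Tg + 1),
      dist (y l t) (z t) < δ := fun δ hδ =>
    eventually_forall_dist_lt_of_perturbed hK hM hz hy' hy0 _ hδ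
  have hT : Tendsto T (𝓝[≠] 0) (𝓝 Tg) := tendsto_mainPeriod hG hGc hR hRc hz hTg hper hmin hy hy0
    hclose hTpos hTper hTmin (hper ▸ ha)
  have hvar : Tendsto (fun l => l⁻¹ * ((y l Tg).2 - (z Tg).2)) (𝓝[≠] 0) (𝓝 (w Tg).2) :=
    (continuous_snd.tendsto _).comp (tendsto_inv_smul_sub_of_variation hK hK'
      (hG.hamiltonianField.differentiable one_ne_zero)
      ((hGc.hamiltonianField.fderiv (𝕜 := ℝ)).uniformContinuous_of_continuous
        (hG.hamiltonianField.continuous_fderiv one_ne_zero)) hz hy' hy0 hTg.le hw0 hw)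
  have hmvt : ∀ᶠ l in 𝓝[≠] (0 : ℝ), ∃ ξ ∈ uIcc Tg (T l), (y l (T l)).2 - (y l Tg).2 =
      (pd1 G (y l ξ) + l * pd1 R (y l ξ)) * (T l - Tg) := by
    filter_upwards [hy] with l hl
    have hd : ∀ t, HasDerivAt (fun t => (y l t).2) (pd1 G (y l t) + l * pd1 R (y l t)) t :=
      fun t => by
        rw [← pd1_add_mul (hGd _) (hRd _)]
        exact (hasFDerivAt_snd (𝕜 := ℝ) (p := y l t)).comp_hasDerivAt t (hl t)
    have hc : Continuous fun t => (y l t).2 :=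
      continuous_iff_continuousAt.2 fun t => (hd t).continuousAt
    rcases lt_trichotomy Tg (T l) with hlt | heq | hgt
    · obtain ⟨ξ, hξ, e⟩ := exists_hasDerivAt_eq_slope _ _ hlt hc.continuousOn fun t _ => hd t
      refine ⟨ξ, Icc_subset_uIcc (Ioo_subset_Icc_self hξ), ?_⟩
      rw [e, div_mul_cancel₀ _ (sub_ne_zero.2 hlt.ne')]
    · exact ⟨Tg, left_mem_uIcc, by simp [← heq]⟩
    · obtain ⟨ξ, hξ, e⟩ := exists_hasDerivAt_eq_slope _ _ hgt hc.continuousOn fun t _ => hd t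
      refine ⟨ξ, Icc_subset_uIcc' (Ioo_subset_Icc_self hξ), ?_⟩
      rw [e, ← neg_sub Tg (T l), mul_neg, div_mul_cancel₀ _ (sub_ne_zero.2 hgt.ne'), neg_sub]
  obtain ⟨ξ, hξ⟩ := hmvt.choice
  have hξT : Tendsto ξ (𝓝[≠] 0) (𝓝 Tg) := by
    rw [tendsto_iff_dist_tendsto_zero] at hT ⊢
    refine squeeze_zero' (Eventually.of_forall fun _ => dist_nonneg) ?_ hT
    filter_upwards [hξ] with l hl
    rw [Real.dist_eq, Real.dist_eq]
    exact abs_sub_left_of_mem_uIcc hl.1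
  have hyξ : Tendsto (fun l => y l (ξ l)) (𝓝[≠] 0) (𝓝 (z Tg)) := by
    have hzξ : Tendsto (fun l => z (ξ l)) (𝓝[≠] 0) (𝓝 (z Tg)) := (hzc.tendsto Tg).comp hξT
    refine hzξ.congr_dist (Metric.tendsto_nhds.2 fun δ hδ => ?_)
    filter_upwards [hclose δ hδ, hξT.eventually (Icc_mem_nhds hTg (lt_add_one Tg))] with l hl hm
    simpa [dist_comm] using hl _ hm
  have hslope : Tendsto (fun l => pd1 G (y l (ξ l)) + l * pd1 R (y l (ξ l))) (𝓝[≠] 0)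
      (𝓝 (pd1 G (z Tg))) := by
    simpa using ((hG.pd1.continuous.tendsto _).comp hyξ).add
      ((tendsto_id.mono_left nhdsWithin_le_nhds).mul ((hR.pd1.continuous.tendsto _).comp hyξ))
  refine (hvar.neg.div hslope ha).congr' ?_
  filter_upwards [hξ, hTper, hslope.eventually_ne ha, self_mem_nhdsWithin] with l hl hTl hne hl0
  replace hl0 : l ≠ 0 := hl0
  have e := hl.2
  rw [hTl, ← hper] at e
  rw [Pi.div_apply, ← mul_neg, neg_sub, e]
  field_simp

end Period

/-- If `z₂'(T_g) ≠ 0` (and `z₂'(T_g) = ∂₁g(z(T_g))` by the Hamiltonian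
system), then the main period `T_λ` of the perturbed Hamiltonian system (for `g + λr`)
satisfies `(T_λ − T_g)/λ → −w₂(T_g)/z₂'(T_g)` as `λ → 0`, where `w` solves the system
in variations. -/
theorem period_directional_derivative
    (D : Set (ℝ × ℝ)) (hDo : IsOpen D) (hDb : Bornology.IsBounded D)
    (hDc : IsConnected D)
    (g r : ℝ × ℝ → ℝ)
    (U : Set (ℝ × ℝ)) (hUo : IsOpen U) (hDU : closure D ⊆ U)
    (hg : ContDiffOn ℝ 2 g U) (hr : ContDiffOn ℝ 2 r U)
    (hpos : ∀ x ∈ frontier D, 0 < g x)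
    (hgrad : ∀ x ∈ D, g x = 0 → fderiv ℝ g x ≠ 0)
    (x₀ : ℝ × ℝ) (hx₀ : x₀ ∈ D) (hgx₀ : g x₀ = 0)
    -- the periodic solution `z` with main period `Tg`
    (Tg : ℝ) (hTg : 0 < Tg) (z : ℝ → ℝ × ℝ)
    (hz1 : ∀ t : ℝ, HasDerivAt (fun s => (z s).1) (-pd2 g (z t)) t)
    (hz2 : ∀ t : ℝ, HasDerivAt (fun s => (z s).2) (pd1 g (z t)) t)
    (hz0 : z 0 = x₀)
    (hper : ∀ t : ℝ, z (t + Tg) = z t)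
    (hmin : ∀ T : ℝ, 0 < T → (∀ t : ℝ, z (t + T) = z t) → Tg ≤ T)
    -- the perturbed periodic solutions `zl λ` with main periods `T λ`, for `λ` near `0`
    (ε : ℝ) (hε : 0 < ε) (zl : ℝ → ℝ → ℝ × ℝ) (T : ℝ → ℝ)
    (hzl1 : ∀ l : ℝ, |l| < ε → l ≠ 0 → ∀ t : ℝ,
      HasDerivAt (fun s => (zl l s).1) (-pd2 (fun y => g y + l * r y) (zl l t)) t)
    (hzl2 : ∀ l : ℝ, |l| < ε → l ≠ 0 → ∀ t : ℝ,
      HasDerivAt (fun s => (zl l s).2) (pd1 (fun y => g y + l * r y) (zl l t)) t)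
    (hzl0 : ∀ l : ℝ, |l| < ε → l ≠ 0 → zl l 0 = x₀)
    (hTl : ∀ l : ℝ, |l| < ε → l ≠ 0 → 0 < T l)
    (hperl : ∀ l : ℝ, |l| < ε → l ≠ 0 → ∀ t : ℝ, zl l (t + T l) = zl l t)
    (hminl : ∀ l : ℝ, |l| < ε → l ≠ 0 →
      ∀ S : ℝ, 0 < S → (∀ t : ℝ, zl l (t + S) = zl l t) → T l ≤ S)
    -- `w` is the solution of the system in variations on `[0, Tg]`
    (w : ℝ → ℝ × ℝ) (hw0 : w 0 = (0, 0))
    (hw1 : ∀ t ∈ Set.Icc (0 : ℝ) Tg,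
      HasDerivWithinAt (fun s => (w s).1)
        (-(pd1 (fun y => pd2 g y) (z t) * (w t).1 + pd2 (fun y => pd2 g y) (z t) * (w t).2)
          - pd2 r (z t)) (Set.Icc 0 Tg) t)
    (hw2 : ∀ t ∈ Set.Icc (0 : ℝ) Tg,
      HasDerivWithinAt (fun s => (w s).2)
        ((pd1 (fun y => pd1 g y) (z t) * (w t).1 + pd2 (fun y => pd1 g y) (z t) * (w t).2)
          + pd1 r (z t)) (Set.Icc 0 Tg) t)
    -- `z₂'(Tg) = ∂₁g(z(Tg)) ≠ 0`
    (hz2' : pd1 g (z Tg) ≠ 0) :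
    Tendsto (fun l : ℝ => (T l - Tg) / l) (𝓝[≠] (0 : ℝ))
      (𝓝 (-(w Tg).2 / pd1 g (z Tg))) := by
  have hK : IsCompact (closure D) := hDb.isCompact_closure
  obtain ⟨G, hG, hGc, hGe⟩ := exists_contDiff_hasCompactSupport_eventuallyEq hK hUo hDU hg
  obtain ⟨R, hR, hRc, hRe⟩ := exists_contDiff_hasCompactSupport_eventuallyEq hK hUo hDU hr
  have hGd : Differentiable ℝ G := hG.differentiable two_ne_zero
  have hRd : Differentiable ℝ R := hR.differentiable two_ne_zero
  have hcl : ∀ {x}, x ∈ D → x ∈ closure D := fun hx => subset_closure hx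
  have hfield : ∀ (l : ℝ), ∀ x ∈ D, (fun y => g y + l * r y) =ᶠ[𝓝 x] fun y => G y + l * R y :=
    fun l x hx => by
      filter_upwards [hGe x (hcl hx), hRe x (hcl hx)] with y h1 h2
      rw [h1, h2]
  have hfr : ∀ x ∈ frontier D, 0 < G x := fun x hx => by
    rw [(hGe x (frontier_subset_closure hx)).eq_of_nhds]; exact hpos x hx
  have hGx₀ : G x₀ = 0 := (hGe x₀ (hcl hx₀)).eq_of_nhds.trans hgx₀
  -- a trajectory of the perturbed system stays in `D`, so it solves the modified system
  have hsolves : ∀ (l : ℝ) (u : ℝ → ℝ × ℝ), u 0 = x₀ →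
      (∀ x ∈ frontier D, G x + l * R x ≠ G x₀ + l * R x₀) →
      (∀ t, HasDerivAt (fun s => (u s).1) (-pd2 (fun y => g y + l * r y) (u t)) t) →
      (∀ t, HasDerivAt (fun s => (u s).2) (pd1 (fun y => g y + l * r y) (u t)) t) →
      ∀ t, u t ∈ D ∧ HasDerivAt u (hamiltonianField (fun y => G y + l * R y) (u t)) t := by
    intro l u hu0 hl hu1 hu2
    have hu : ∀ t, HasDerivAt u (hamiltonianField (fun y => g y + l * r y) (u t)) t := fun t =>
      (hu1 t).prodMk (hu2 t)
    have hu' : ∀ t, u t ∈ D →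
        HasDerivAt u (hamiltonianField (fun y => G y + l * R y) (u t)) t := fun t ht => by
      have h := hu t
      have e := hfield l _ ht
      rwa [hamiltonianField, (pd1_congr e).eq_of_nhds, (pd2_congr e).eq_of_nhds] at h
    have hdiff : Differentiable ℝ fun y => G y + l * R y := by fun_prop
    have hmem : ∀ t, u t ∈ D := forall_mem_of_deriv_comp_eq_zero hDo
      hdiff.continuous.continuousOn (continuous_iff_continuousAt.2 fun t => (hu t).continuousAt)
      (hu0 ▸ hx₀) (fun t ht => hasDerivAt_hamiltonian_comp (hu' t ht) (hdiff _))
      (by simpa only [hu0] using hl)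
    exact fun t => ⟨hmem t, hu' t (hmem t)⟩
  have hzsol := hsolves 0 z hz0 (fun x hx => by simpa [hGx₀] using (hfr x hx).ne')
    (by simpa using hz1) (by simpa using hz2)
  simp only [zero_mul, add_zero] at hzsol
  have hlfr : ∀ᶠ l in 𝓝 (0 : ℝ), ∀ x ∈ frontier D, G x + l * R x ≠ G x₀ + l * R x₀ := by
    have hfrc : IsCompact (frontier D) :=
      hK.of_isClosed_subset isClosed_frontier frontier_subset_closure
    exact hfrc.eventually_forall_of_forall_eventually (x₀ := (0 : ℝ))
      (P := fun l x => G x + l * R x ≠ G x₀ + l * R x₀) fun x hx => by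
        have hc : Continuous fun q : ℝ × (ℝ × ℝ) =>
            G q.2 + q.1 * R q.2 - (G x₀ + q.1 * R x₀) := by
          have := hGd.continuous
          have := hRd.continuous
          fun_prop
        filter_upwards [(hc.tendsto ((0 : ℝ), x)).eventually_ne (b₂ := 0)
          (by simpa [hGx₀] using (hfr x hx).ne')] with q hq
        exact sub_ne_zero.1 hq
  have hlε : ∀ᶠ l in 𝓝[≠] (0 : ℝ), |l| < ε ∧ l ≠ 0 :=
    ((((continuous_abs.tendsto' (0 : ℝ) 0 (by simp)).mono_left
      nhdsWithin_le_nhds).eventually_lt_const hε).and self_mem_nhdsWithin)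
  have hpdG : ∀ t, pd1 g =ᶠ[𝓝 (z t)] pd1 G ∧ pd2 g =ᶠ[𝓝 (z t)] pd2 G := fun t =>
    have e := (hGe _ (hcl (hzsol t).1)).symm
    ⟨pd1_congr e, pd2_congr e⟩
  rw [(hpdG Tg).1.eq_of_nhds] at hz2' ⊢
  refine tendsto_mainPeriod_slope hG hGc hR hRc (fun t => (hzsol t).2) hTg
    (by simpa using hper 0) hmin (y := zl) ?_ ?_ ?_ ?_ ?_ hw0 ?_ hz2'
  · filter_upwards [hlε, nhdsWithin_le_nhds hlfr] with l hl hlf t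
    exact (hsolves l (zl l) (hzl0 l hl.1 hl.2) hlf (hzl1 l hl.1 hl.2) (hzl2 l hl.1 hl.2) t).2
  · exact hlε.mono fun l hl => (hzl0 l hl.1 hl.2).trans hz0.symm
  · exact hlε.mono fun l hl => hTl l hl.1 hl.2
  · exact hlε.mono fun l hl => by
      have := hperl l hl.1 hl.2 0
      rwa [zero_add, hzl0 l hl.1 hl.2, ← hz0] at this
  · exact hlε.mono fun l hl => hminl l hl.1 hl.2
  · intro t ht
    have eR := (hRe _ (hcl (hzsol t).1)).symm
    have h := (hw1 t ht).prodMk (hw2 t ht)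
    rw [(pd1_congr eR).eq_of_nhds, (pd2_congr eR).eq_of_nhds,
      (pd1_congr (hpdG t).1).eq_of_nhds, (pd2_congr (hpdG t).1).eq_of_nhds,
      (pd1_congr (hpdG t).2).eq_of_nhds, (pd2_congr (hpdG t).2).eq_of_nhds] at h
    rw [fderiv_hamiltonianField_apply hG, hamiltonianField, Prod.mk_add_mk, ← sub_eq_add_neg]
    exact h
end
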